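/- Consider the set Δ̄* consisting of: the points (u,v) ∈ ℝ² with u < v (the set Δ⁺), the points (u,∞) with u ∈ ℝ, and one additional point Δ. Define d : Δ̄* × Δ̄* → [0,∞] by: d((u,v),(u′,v′)) = min{ max(|u−u′|, |v−v′|), max((v−u)/2, (v′−u′)/2) } for (u,v),(u′,v′) ∈ Δ⁺; d((u,∞),(u′,∞)) = |u−u′|; d((u,v),Δ) = d(Δ,(u,v)) = (v−u)/2 for (u,v) ∈ Δ⁺; d(Δ,Δ) = 0; and d(p,q) = ∞ in all remaining cases (i.e., between a point of Δ⁺ ∪ {Δ} and a point of the form (u,∞)). Then d is an extended metric on Δ̄*: d is symmetric, d(p,q) = 0 if and only if p = q, and d satisfies the triangle inequality d(p,r) ≤ d(p,q) + d(q,r) for all p, q, r ∈ Δ̄*. -/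

import Mathlib

open scoped ENNReal

/-- The extended persistence plane `Δ̄*`: points `(u,v)` with `u < v` (the set `Δ⁺`),
points `(u, ∞)` encoded by their finite coordinate `u ∈ ℝ`, and one extra point `Δ`. -/
abbrev BarDeltaStar : Type := {p : ℝ × ℝ // p.1 < p.2} ⊕ ℝ ⊕ Unit

/-- The extended distance `d` on `Δ̄*`. -/
noncomputable def dDelta : BarDeltaStar → BarDeltaStar → ℝ≥0∞
  | Sum.inl ⟨(u, v), _⟩, Sum.inl ⟨(u', v'), _⟩ =>
      ENNReal.ofReal
        (min (max |u - u'| |v - v'|) (max ((v - u) / 2) ((v' - u') / 2)))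
  | Sum.inr (Sum.inl u), Sum.inr (Sum.inl u') => ENNReal.ofReal |u - u'|
  | Sum.inl ⟨(u, v), _⟩, Sum.inr (Sum.inr _) => ENNReal.ofReal ((v - u) / 2)
  | Sum.inr (Sum.inr _), Sum.inl ⟨(u', v'), _⟩ => ENNReal.ofReal ((v' - u') / 2)
  | Sum.inr (Sum.inr _), Sum.inr (Sum.inr _) => 0
  | _, _ => ∞

/-- Distance to the diagonal changes by at most the sup distance of the points. -/
lemma half_sub_le_max_abs_add (u v u' v' : ℝ) :
    (v - u) / 2 ≤ max |u - u'| |v - v'| + (v' - u') / 2 := by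
  have h₁ := (neg_le_abs (u - u')).trans (le_max_left _ |v - v'|)
  have h₂ := (le_abs_self (v - v')).trans (le_max_right |u - u'| _)
  linarith

/-- The sup distance on the plane, capped by the larger of the distances to the diagonal. -/
noncomputable def cappedDist (u v u' v' : ℝ) : ℝ :=
  min (max |u - u'| |v - v'|) (max ((v - u) / 2) ((v' - u') / 2))

lemma cappedDist_comm (u v u' v' : ℝ) : cappedDist u v u' v' = cappedDist u' v' u v := by
  simp only [cappedDist, abs_sub_comm u, abs_sub_comm v, max_comm ((v - u) / 2)]

lemma cappedDist_nonneg {u v : ℝ} (u' v' : ℝ) (h : u < v) : 0 ≤ cappedDist u v u' v' :=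
  le_min ((abs_nonneg _).trans (le_max_left _ _)) (le_max_of_le_left (by linarith))

lemma cappedDist_le_zero_iff {u v u' v' : ℝ} (h : u < v) :
    cappedDist u v u' v' ≤ 0 ↔ u = u' ∧ v = v' := by
  have h₀ : ¬ (v - u) / 2 ≤ 0 := by linarith
  simp [cappedDist, h₀, sub_eq_zero, -not_le]

lemma half_sub_le_cappedDist_add {u v u' v' : ℝ} (h' : u' < v') :
    (v - u) / 2 ≤ cappedDist u v u' v' + (v' - u') / 2 := by
  have h₁ := half_sub_le_max_abs_add u v u' v'
  have h₂ := le_max_left ((v - u) / 2) ((v' - u') / 2)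
  unfold cappedDist
  rcases min_choice (max |u - u'| |v - v'|) (max ((v - u) / 2) ((v' - u') / 2)) with h | h <;>
    rw [h] <;> linarith

lemma cappedDist_le_half_add_half {u v u' v' : ℝ} (h : u < v) (h' : u' < v') :
    cappedDist u v u' v' ≤ (v - u) / 2 + (v' - u') / 2 :=
  (min_le_right _ _).trans (max_le (by linarith) (by linarith))

lemma cappedDist_triangle {u v u' v' u'' v'' : ℝ} (h' : u' < v') :
    cappedDist u v u'' v'' ≤ cappedDist u v u' v' + cappedDist u' v' u'' v'' := by
  have a₁ := half_sub_le_max_abs_add u v u' v'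
  have a₂ := half_sub_le_max_abs_add u'' v'' u' v'
  rw [abs_sub_comm u'', abs_sub_comm v''] at a₂
  have b₁ := le_max_left ((v - u) / 2) ((v' - u') / 2)
  have b₂ := le_max_right ((v - u) / 2) ((v' - u') / 2)
  have c₁ := le_max_left ((v' - u') / 2) ((v'' - u'') / 2)
  have c₂ := le_max_right ((v' - u') / 2) ((v'' - u'') / 2)
  have d₁ := (abs_nonneg _).trans (le_max_left |u - u'| |v - v'|)
  have d₂ := (abs_nonneg _).trans (le_max_left |u' - u''| |v' - v''|)
  unfold cappedDist
  rcases min_choice (max |u - u'| |v - v'|) (max ((v - u) / 2) ((v' - u') / 2)) with e | e <;>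
    rcases min_choice (max |u' - u''| |v' - v''|) (max ((v' - u') / 2) ((v'' - u'') / 2))
      with f | f <;> rw [e, f]
  · refine (min_le_left _ _).trans (max_le ?_ ?_)
    · exact (abs_sub_le u u' u'').trans (add_le_add (le_max_left _ _) (le_max_left _ _))
    · exact (abs_sub_le v v' v'').trans (add_le_add (le_max_right _ _) (le_max_right _ _))
  all_goals exact (min_le_right _ _).trans (max_le (by linarith) (by linarith))

/-- `d` is an extended metric on `Δ̄*`: it is symmetric, vanishes exactly on the
diagonal, and satisfies the triangle inequality. -/
theorem stmt_3 :
    (∀ p q : BarDeltaStar, dDelta p q = dDelta q p) ∧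
    (∀ p q : BarDeltaStar, dDelta p q = 0 ↔ p = q) ∧
    (∀ p q r : BarDeltaStar, dDelta p r ≤ dDelta p q + dDelta q r) := by
  refine ⟨?_, ?_, ?_⟩
  · rintro (⟨⟨u, v⟩, h⟩ | u | _) (⟨⟨u', v'⟩, h'⟩ | u' | _) <;> simp only [dDelta]
    · exact congrArg ENNReal.ofReal (cappedDist_comm u v u' v')
    · rw [abs_sub_comm]
  · rintro (⟨⟨u, v⟩, h⟩ | u | _) (⟨⟨u', v'⟩, h'⟩ | u' | _) <;> simp only [dDelta]
    · refine ENNReal.ofReal_eq_zero.trans ((cappedDist_le_zero_iff h).trans ?_)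
      simp
    · simp
    · simpa using h
    · simp
    · simp [sub_eq_zero]
    · simp
    · simpa using h'
    · simp
  · rintro (⟨⟨u, v⟩, h⟩ | u | _) (⟨⟨u', v'⟩, h'⟩ | u' | _) (⟨⟨u'', v''⟩, h''⟩ | u'' | _) <;>
      simp only [dDelta, ← cappedDist.eq_def, top_add, add_top, le_top, zero_add, add_zero, le_refl,
        zero_le]
    · rw [← ENNReal.ofReal_add (cappedDist_nonneg u' v' h) (cappedDist_nonneg u'' v'' h')]
      exact ENNReal.ofReal_le_ofReal (cappedDist_triangle h')
    · rw [← ENNReal.ofReal_add (cappedDist_nonneg u' v' h) (by linarith)]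
      exact ENNReal.ofReal_le_ofReal (half_sub_le_cappedDist_add h')
    · rw [← ENNReal.ofReal_add (by linarith) (by linarith)]
      exact ENNReal.ofReal_le_ofReal (cappedDist_le_half_add_half h h'')
    · rw [← ENNReal.ofReal_add (abs_nonneg _) (abs_nonneg _)]
      exact ENNReal.ofReal_le_ofReal (abs_sub_le u u' u'')
    · rw [← ENNReal.ofReal_add (by linarith) (cappedDist_nonneg u'' v'' h')]
      refine ENNReal.ofReal_le_ofReal ?_
      have := half_sub_le_cappedDist_add (u := u'') (v := v'') h'
      rw [cappedDist_comm] at this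
      linarith
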